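/- arXiv:0705.0346 — 2 statements merged into one kernel-verified Lean document; each statement's English description precedes it below -/
import Mathlib

section
/- For every η ∈ ℝ and every j ∈ {0,…,g} one has λ_j < z_j(η) < λ_{j+1} (with the conventions λ_0 = −∞ and λ_{g+1} = +∞, meaning no constraint on the corresponding side). In particular, each interval (λ_j, λ_{j+1}) contains exactly one root of P_η for every η. -/
/-- Let `g ≥ 1`, `λ_1 < ⋯ < λ_g` real (with conventions `λ_0 = −∞`, `λ_{g+1} = +∞`),
`tλ_0, …, tλ_g` pairwise distinct reals, none equal to any `λ_k`, with exactly one in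
each interval `(λ_j, λ_{j+1})`.  For `η ∈ ℝ` let
`P_η(x) = ∏_{k=0}^{g}(x − tλ_k) + η ∏_{k=1}^{g}(x − λ_k)` and assume the continuous
functions `z_0 < z_1 < ⋯ < z_g` give the roots of `P_η`:
`P_η(x) = ∏_{k=0}^{g}(x − z_k(η))`.  Then for every `η` and every `j ∈ {0,…,g}` one has
`λ_j < z_j(η) < λ_{j+1}` (no condition on the infinite sides `j = 0`, `j = g`), and each
interval `(λ_j, λ_{j+1})` contains exactly one root of `P_η`. -/
theorem stationary_phase_points_location
    (g : ℕ) (hg : 1 ≤ g) (lam tlam : ℕ → ℝ)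
    (hlam : ∀ k, 1 ≤ k → k < g → lam k < lam (k + 1))
    (htlam_distinct : ∀ j k, j ≤ g → k ≤ g → j ≠ k → tlam j ≠ tlam k)
    (htlam_ne : ∀ j k, j ≤ g → 1 ≤ k → k ≤ g → tlam j ≠ lam k)
    (htlam_loc : ∀ j, j ≤ g →
      ∃! k, k ≤ g ∧ (j = 0 ∨ lam j < tlam k) ∧ (j = g ∨ tlam k < lam (j + 1)))
    (z : ℕ → ℝ → ℝ)
    (hzcont : ∀ k, k ≤ g → Continuous (z k))
    (hzord : ∀ η : ℝ, ∀ k, k < g → z k η < z (k + 1) η)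
    (hroots : ∀ η x : ℝ,
      (∏ k ∈ Finset.range (g + 1), (x - tlam k)) +
        η * ∏ k ∈ Finset.Icc 1 g, (x - lam k) =
      ∏ k ∈ Finset.range (g + 1), (x - z k η)) :
    ∀ η : ℝ, ∀ j, j ≤ g →
      ((j = 0 ∨ lam j < z j η) ∧ (j = g ∨ z j η < lam (j + 1))) ∧
      (∃! x : ℝ,
        ((∏ k ∈ Finset.range (g + 1), (x - tlam k)) +
          η * ∏ k ∈ Finset.Icc 1 g, (x - lam k) = 0) ∧
        (j = 0 ∨ lam j < x) ∧ (j = g ∨ x < lam (j + 1))) := by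
  have lmono : ∀ a, 1 ≤ a → ∀ d, a + d ≤ g → lam a ≤ lam (a + d) := by
    intro a ha d
    induction d with
    | zero => intro _; exact le_refl _
    | succ d ih =>
      intro h
      exact (ih (by omega)).trans (hlam (a + d) (by omega) (by omega)).le
  have lmono' : ∀ a b, 1 ≤ a → a ≤ b → b ≤ g → lam a ≤ lam b := by
    intro a b ha hab hb
    obtain ⟨d, rfl⟩ := Nat.exists_eq_add_of_le hab
    exact lmono a ha d hb
  have zmono : ∀ η a d, a + d ≤ g → z a η ≤ z (a + d) η := by
    intro η a d
    induction d with
    | zero => intro _; exact le_refl _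
    | succ d ih =>
      intro h
      exact (ih (by omega)).trans (hzord η (a + d) (by omega)).le
  have zmono' : ∀ η a b, a ≤ b → b ≤ g → z a η ≤ z b η := by
    intro η a b hab hb
    obtain ⟨d, rfl⟩ := Nat.exists_eq_add_of_le hab
    exact zmono η a d hb
  have isroot : ∀ η x, (∏ k ∈ Finset.range (g + 1), (x - tlam k)) +
          η * ∏ k ∈ Finset.Icc 1 g, (x - lam k) = 0 → ∃ m, m ≤ g ∧ x = z m η := by
    intro η x hx
    rw [hroots, Finset.prod_eq_zero_iff] at hx
    obtain ⟨m, hm, h⟩ := hx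
    exact ⟨m, by simpa [Nat.lt_succ_iff] using hm, sub_eq_zero.mp h⟩
  have rootz : ∀ η m, m ≤ g → (∏ k ∈ Finset.range (g + 1), (z m η - tlam k)) +
          η * ∏ k ∈ Finset.Icc 1 g, (z m η - lam k) = 0 := by
    intro η m hm
    rw [hroots]
    exact Finset.prod_eq_zero (Finset.mem_range.mpr (Nat.lt_succ_of_le hm)) (sub_self _)
  have zne : ∀ η m k, m ≤ g → 1 ≤ k → k ≤ g → z m η ≠ lam k := by
    intro η m k hm hk hkg h
    have h1 := rootz η m hm
    rw [h, Finset.prod_eq_zero (i := k) (s := Finset.Icc 1 g)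
      (Finset.mem_Icc.mpr ⟨hk, hkg⟩) (sub_self _), mul_zero, add_zero,
      Finset.prod_eq_zero_iff] at h1
    obtain ⟨i, hi, h2⟩ := h1
    exact htlam_ne i k (Nat.lt_succ_iff.mp (Finset.mem_range.mp hi)) hk hkg
      (sub_eq_zero.mp h2).symm
  have ex : ∀ j, ∃ m, j ≤ g → m ≤ g ∧ (j = 0 ∨ lam j < z m 0) ∧
      (j = g ∨ z m 0 < lam (j + 1)) := by
    intro j
    by_cases hj : j ≤ g
    · obtain ⟨k, ⟨hk, h1, h2⟩, _⟩ := htlam_loc j hj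
      obtain ⟨m, hm, e⟩ := isroot 0 (tlam k) (by
        rw [zero_mul, add_zero]
        exact Finset.prod_eq_zero (Finset.mem_range.mpr (Nat.lt_succ_of_le hk)) (sub_self _))
      exact ⟨m, fun _ => ⟨hm, e ▸ h1, e ▸ h2⟩⟩
    · exact ⟨0, fun h => absurd h hj⟩
  choose σ hσ using ex
  have σstep : ∀ j, j + 1 ≤ g → σ j + 1 ≤ σ (j + 1) := by
    intro j hj
    obtain ⟨a1, a2, a3⟩ := hσ j (by omega)
    obtain ⟨b1, b2, b3⟩ := hσ (j + 1) hj
    have a3 := a3.resolve_left (by omega)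
    have b2 := b2.resolve_left (by omega)
    by_contra hc
    have := zmono' 0 (σ (j + 1)) (σ j) (by omega) a1
    linarith
  have σd : ∀ j d, j + d ≤ g → σ j + d ≤ σ (j + d) := by
    intro j d
    induction d with
    | zero => intro _; exact le_refl _
    | succ d ih =>
      intro h
      have h1 := ih (by omega)
      have h2 := σstep (j + d) (by omega)
      have h3 : j + (d + 1) = j + d + 1 := by omega
      rw [h3]; omega
  have σeq : ∀ j, j ≤ g → σ j = j := by
    intro j hj
    have h1 := σd 0 j (by omega)
    have h2 := σd j (g - j) (by omega)
    rw [Nat.add_sub_cancel' hj] at h2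
    have h3 := (hσ g le_rfl).1
    rw [Nat.zero_add] at h1
    omega
  have loc : ∀ η j, j ≤ g → (j = 0 ∨ lam j < z j η) ∧ (j = g ∨ z j η < lam (j + 1)) := by
    intro η j hj
    obtain ⟨_, h1, h2⟩ := hσ j hj
    rw [σeq j hj] at h1 h2
    constructor
    · by_cases h0 : j = 0
      · exact Or.inl h0
      · right
        have h1 := h1.resolve_left h0
        by_contra hc
        obtain ⟨y, hy⟩ := mem_range_of_exists_le_of_exists_ge (hzcont j hj)
          ⟨η, not_lt.mp hc⟩ ⟨0, h1.le⟩
        exact zne y j j hj (by omega) hj hy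
    · by_cases h0 : j = g
      · exact Or.inl h0
      · right
        have h2 := h2.resolve_left h0
        by_contra hc
        obtain ⟨y, hy⟩ := mem_range_of_exists_le_of_exists_ge (hzcont j hj)
          ⟨0, h2.le⟩ ⟨η, not_lt.mp hc⟩
        exact zne y j (j + 1) hj (by omega) (by omega) hy
  intro η j hj
  refine ⟨loc η j hj, z j η, ⟨rootz η j hj, loc η j hj⟩, ?_⟩
  rintro x ⟨hx, h1, h2⟩
  obtain ⟨m, hm, rfl⟩ := isroot η x hx
  obtain ⟨c1, c2⟩ := loc η m hm
  rcases lt_trichotomy m j with h | h | h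
  · have h1 := h1.resolve_left (by omega)
    have c2 := c2.resolve_left (by omega)
    have := lmono' (m + 1) j (by omega) h hj
    linarith
  · rw [h]
  · have h2 := h2.resolve_left (by omega)
    have c1 := c1.resolve_left (by omega)
    have := lmono' (j + 1) m (by omega) h hm
    linarith
end

section
/- Each function z_j (j = 0,…,g) is differentiable on ℝ with derivative z_j'(η) = − ∏_{k=1}^{g}(z_j(η) − λ_k) / ∏_{k=0, k≠j}^{g}(z_j(η) − z_k(η)). Moreover z_j'(η) < 0 for all η ∈ ℝ; in particular every z_j is strictly decreasing. -/
/-- In the setting of the stationary phase points `z_0 < ⋯ < z_g` of the phase (the roots of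
`P_η(x) = ∏_{k=0}^{g}(x − tλ_k) + η ∏_{k=1}^{g}(x − λ_k)`), each `z_j` is differentiable
on `ℝ` with derivative
`z_j'(η) = − ∏_{k=1}^{g}(z_j(η) − λ_k) / ∏_{k≠j}(z_j(η) − z_k(η))`,
this derivative is strictly negative, and in particular `z_j` is strictly decreasing. -/
theorem stationary_phase_points_deriv
    (g : ℕ) (hg : 1 ≤ g) (lam tlam : ℕ → ℝ)
    (hlam : ∀ k, 1 ≤ k → k < g → lam k < lam (k + 1))
    (htlam_distinct : ∀ j k, j ≤ g → k ≤ g → j ≠ k → tlam j ≠ tlam k)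
    (htlam_ne : ∀ j k, j ≤ g → 1 ≤ k → k ≤ g → tlam j ≠ lam k)
    (htlam_loc : ∀ j, j ≤ g →
      ∃! k, k ≤ g ∧ (j = 0 ∨ lam j < tlam k) ∧ (j = g ∨ tlam k < lam (j + 1)))
    (z : ℕ → ℝ → ℝ)
    (hzcont : ∀ k, k ≤ g → Continuous (z k))
    (hzord : ∀ η : ℝ, ∀ k, k < g → z k η < z (k + 1) η)
    (hroots : ∀ η x : ℝ,
      (∏ k ∈ Finset.range (g + 1), (x - tlam k)) +
        η * ∏ k ∈ Finset.Icc 1 g, (x - lam k) =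
      ∏ k ∈ Finset.range (g + 1), (x - z k η)) :
    ∀ j, j ≤ g →
      (∀ η : ℝ,
        HasDerivAt (z j)
          (-(∏ k ∈ Finset.Icc 1 g, (z j η - lam k)) /
            ∏ k ∈ (Finset.range (g + 1)).erase j, (z j η - z k η)) η ∧
        -(∏ k ∈ Finset.Icc 1 g, (z j η - lam k)) /
            ∏ k ∈ (Finset.range (g + 1)).erase j, (z j η - z k η) < 0) ∧
      StrictAnti (z j) := by
  have zlt : ∀ η : ℝ, ∀ i j, i < j → j ≤ g → z i η < z j η := by
    intro η i j hij
    induction j, hij using Nat.le_induction with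
    | base => intro h; exact hzord η i h
    | succ n hn ih => intro h; exact (ih (by omega)).trans (hzord η n h)
  have zle : ∀ η : ℝ, ∀ i j, i ≤ j → j ≤ g → z i η ≤ z j η := by
    intro η i j hij hj
    rcases hij.eq_or_lt with h | h
    · rw [h]
    · exact (zlt η i j h hj).le
  have lamle : ∀ i j, 1 ≤ i → i ≤ j → j ≤ g → lam i ≤ lam j := by
    intro i j hi hij
    induction j, hij using Nat.le_induction with
    | base => intro h; exact le_rfl
    | succ n hn ih => intro h; exact (ih (by omega)).trans (hlam n (by omega) (by omega)).le
  -- location at zero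
  have hsig : ∀ j, ∃ i, j ≤ g → i ≤ g ∧ (j = 0 ∨ lam j < z i 0) ∧ (j = g ∨ z i 0 < lam (j + 1)) := by
    intro j
    by_cases hj : j ≤ g
    · obtain ⟨k, ⟨hk, h1, h2⟩, -⟩ := htlam_loc j hj
      have h := hroots 0 (tlam k)
      rw [Finset.prod_eq_zero (i := k) (Finset.mem_range.2 (by omega)) (sub_self _)] at h
      have h' := h.symm
      simp only [zero_mul, add_zero] at h'
      obtain ⟨i, hi, hi'⟩ := Finset.prod_eq_zero_iff.1 h'
      have e : z i 0 = tlam k := by linarith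
      refine ⟨i, fun _ => ⟨by have := Finset.mem_range.1 hi; omega, ?_⟩⟩
      rw [e]; exact ⟨h1, h2⟩
    · exact ⟨0, fun h => absurd h hj⟩
  choose σ hσ using hsig
  have hσs : ∀ j, j < g → σ j < σ (j + 1) := by
    intro j hj
    obtain ⟨a1, -, a3⟩ := hσ j hj.le
    obtain ⟨b1, b2, -⟩ := hσ (j+1) hj
    by_contra hc
    have := zle 0 (σ (j+1)) (σ j) (by omega) a1
    rcases a3 with a3 | a3
    · omega
    rcases b2 with b2 | b2
    · omega
    linarith
  have hge : ∀ j, j ≤ g → j ≤ σ j := by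
    intro j
    induction j with
    | zero => intro _; omega
    | succ n ih => intro h; have := ih (by omega); have := hσs n h; omega
  have hle : ∀ d j, j + d = g → σ j ≤ j := by
    intro d
    induction d with
    | zero => intro j h; have := (hσ j (by omega)).1; omega
    | succ n ih => intro j h; have := ih (j+1) (by omega); have := hσs j (by omega); omega
  have hσid : ∀ j, j ≤ g → σ j = j := fun j hj =>
    le_antisymm (hle (g - j) j (by omega)) (hge j hj)
  have hne : ∀ η j k, j ≤ g → 1 ≤ k → k ≤ g → z j η ≠ lam k := by
    intro η j k hj h1 hk he
    have h := hroots η (lam k)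
    rw [Finset.prod_eq_zero (s := Finset.Icc 1 g) (i := k) (Finset.mem_Icc.2 ⟨h1, hk⟩) (sub_self _),
      Finset.prod_eq_zero (f := fun i => lam k - z i η) (i := j) (Finset.mem_range.2 (by omega))
        (by simp [he])] at h
    simp only [mul_zero, add_zero] at h
    obtain ⟨i, hi, hi'⟩ := Finset.prod_eq_zero_iff.1 h
    have := Finset.mem_range.1 hi
    exact htlam_ne i k (by omega) h1 hk (by linarith)
  have hgt : ∀ η j k, j ≤ g → 1 ≤ k → k ≤ j → lam k < z j η := by
    intro η j k hj h1 hk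
    by_contra hc
    obtain ⟨-, a, -⟩ := hσ j hj
    rw [hσid j hj] at a
    have a' : lam j < z j 0 := by
      rcases a with a | a
      · omega
      · exact a
    have := lamle k j h1 hk hj
    obtain ⟨x, hx⟩ := mem_range_of_exists_le_of_exists_ge (hzcont j hj)
      ⟨η, not_lt.1 hc⟩ ⟨0, by linarith⟩
    exact hne x j k hj h1 (by omega) hx
  have hlt : ∀ η j k, j < k → k ≤ g → z j η < lam k := by
    intro η j k hj hk
    by_contra hc
    obtain ⟨-, -, a⟩ := hσ j (by omega)
    rw [hσid j (by omega)] at a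
    have a' : z j 0 < lam (j+1) := by
      rcases a with a | a
      · omega
      · exact a
    have := lamle (j+1) k (by omega) hj hk
    obtain ⟨x, hx⟩ := mem_range_of_exists_le_of_exists_ge (hzcont j (by omega))
      ⟨0, by linarith⟩ ⟨η, not_lt.1 hc⟩
    exact hne x j k (by omega) (by omega) hk hx
  intro j hj
  have hQ : ∀ η, ∏ k ∈ (Finset.range (g + 1)).erase j, (z j η - z k η) ≠ 0 := by
    intro η
    refine Finset.prod_ne_zero_iff.2 fun k hk => ?_
    rw [Finset.mem_erase, Finset.mem_range] at hk
    rcases lt_or_gt_of_ne hk.1 with h | h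
    · exact (sub_pos.2 (zlt η k j h hj)).ne'
    · exact (sub_neg.2 (zlt η j k h (by omega))).ne
  have hneg : ∀ η, -(∏ k ∈ Finset.Icc 1 g, (z j η - lam k)) /
            ∏ k ∈ (Finset.range (g + 1)).erase j, (z j η - z k η) < 0 := by
    intro η
    have e1 : ∏ k ∈ Finset.Icc 1 g, (z j η - lam k) = ∏ i ∈ Finset.range g, (z j η - lam (i+1)) := by
      refine Finset.prod_nbij' (fun k => k - 1) (fun k => k + 1) ?_ ?_ ?_ ?_ ?_
      · intro a ha; simp at ha ⊢; omega
      · intro a ha; simp at ha ⊢; omega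
      · intro a ha; simp at ha ⊢; omega
      · intro a ha; simp
      · intro a ha; simp at ha; rw [Nat.sub_add_cancel ha.1]
    have e2 : ∏ k ∈ (Finset.range (g + 1)).erase j, (z j η - z k η) =
        ∏ i ∈ Finset.range g, (z j η - z (if i < j then i else i + 1) η) := by
      symm
      refine Finset.prod_nbij' (fun k => if k < j then k else k + 1)
        (fun k => if k < j then k else k - 1) ?_ ?_ ?_ ?_ ?_
      · intro a ha; simp at ha ⊢; split_ifs <;> omega
      · intro a ha; simp at ha ⊢; split_ifs <;> omega
      · intro a ha; simp at ha ⊢; split_ifs <;> omega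
      · intro a ha; simp at ha ⊢; split_ifs <;> omega
      · intro a ha; rfl
    rw [neg_div, neg_lt_zero, e1, e2, ← Finset.prod_div_distrib]
    refine Finset.prod_pos fun i hi => ?_
    have hi := Finset.mem_range.1 hi
    split_ifs with h
    · exact div_pos (sub_pos.2 (hgt η j (i+1) hj (by omega) h)) (sub_pos.2 (zlt η i j h hj))
    · exact div_pos_of_neg_of_neg (sub_neg.2 (hlt η j (i+1) (by omega) hi))
        (sub_neg.2 (zlt η j (i+1) (by omega) hi))
  have hder : ∀ η, HasDerivAt (z j)
          (-(∏ k ∈ Finset.Icc 1 g, (z j η - lam k)) /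
            ∏ k ∈ (Finset.range (g + 1)).erase j, (z j η - z k η)) η := by
    intro η
    rw [hasDerivAt_iff_tendsto_slope]
    have hc := hzcont j hj
    have hcQ : Continuous fun y => ∏ k ∈ (Finset.range (g + 1)).erase j, (z j y - z k η) := by
      fun_prop
    have hcL : Continuous fun y => -∏ k ∈ Finset.Icc 1 g, (z j y - lam k) := by
      fun_prop
    have hT := ((hcL.tendsto η).div (hcQ.tendsto η) (hQ η)).mono_left
      (nhdsWithin_le_nhds (s := {η}ᶜ))
    refine hT.congr' ?_
    have hev := (hcQ.continuousAt (x := η)).eventually_ne (hQ η)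
    filter_upwards [nhdsWithin_le_nhds hev, self_mem_nhdsWithin] with y hy hyη
    have hyη : y - η ≠ 0 := sub_ne_zero.2 hyη
    have h1 := hroots y (z j y)
    rw [Finset.prod_eq_zero (f := fun i => z j y - z i y) (i := j) (Finset.mem_range.2 (by omega))
        (sub_self _)] at h1
    have h2 := hroots η (z j y)
    rw [← Finset.mul_prod_erase (Finset.range (g+1)) (fun i => z j y - z i η)
      (Finset.mem_range.2 (show j < g + 1 by omega))] at h2
    rw [slope_def_field]
    simp only [Pi.div_apply]
    rw [div_eq_div_iff hy hyη]
    linear_combination h2 - h1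
  exact ⟨fun η => ⟨hder η, hneg η⟩,
    strictAnti_of_hasDerivAt_neg hder hneg⟩
end
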